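/- (Theorem 1, variable step-size version.) Let d ∈ ℕ, h₊ > 0, N ∈ ℕ, and step sizes h₀, …, h_{N−1} ∈ (0, h₊]; set t_0 = 0, t_{n+1} = t_n + h_n, and T = t_N. Let ε > 0, ε₀ > 0, constants M, β, δ_φ, δ_F, C̄, C, α ≥ 0, λ > 0, and integers p ≥ 1, q ≥ 1. Let y, ψ : ℝ → ℝ^d, φ_ex, φ_θ : ℝ × ℝ^d → ℝ^d, and one-step maps Φ_n : ℝ^d → ℝ^d for n < N. Assume: (i) ψ(0) = y(0); (ii) for all t ∈ [0, T], ‖y(t) − φ_ex(t/ε, ψ(t))‖ ≤ M·exp(−β·ε₀/ε); (iii) ‖φ_ex(τ, z) − φ_θ(τ, z)‖ ≤ δ_φ·ε for all τ, z; (iv) ‖φ_θ(τ, y₁) − φ_θ(τ, y₂)‖ ≤ (1 + α·ε)·‖y₁ − y₂‖ for all τ, y₁, y₂; (v) for all n < N, ‖ψ(t_{n+1}) − Φ_n(ψ(t_n))‖ ≤ (C̄·h₊^{p+q−1} + C·δ_F)·h_n; (vi) for all n < N and y₁, y₂, ‖Φ_n(y₁) − Φ_n(y₂)‖ ≤ (1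 + λ·h_n)·‖y₁ − y₂‖. Then for every n ≤ N, ‖y(t_n) − φ_θ(t_n/ε, (Φ_{n−1} ∘ ⋯ ∘ Φ_0)(y(0)))‖ ≤ M·exp(−β·ε₀/ε) + δ_φ·ε + (1 + α·ε)·((exp(λ·T) − 1)/λ)·(C̄·h₊^{p+q−1} + C·δ_F). -/

import Mathlib

/-- Theorem 1 of the paper, variable step-size version: the slow-fast error
estimate with a sequence of step sizes `h₀, …, h_{N−1}` bounded by `h₊`,
`t_n = h₀ + ⋯ + h_{n−1}`, `T = t_N`, and the composition `Φ_{n−1} ∘ ⋯ ∘ Φ_0`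
replacing the `n`-fold iterate of a fixed one-step map. -/
theorem slow_fast_error_variable_steps (d : ℕ) (hplus : ℝ) (N : ℕ)
    (hhp : 0 < hplus)
    (h : ℕ → ℝ) (hsteps : ∀ n < N, 0 < h n ∧ h n ≤ hplus)
    (t : ℕ → ℝ) (ht0 : t 0 = 0) (htrec : ∀ n < N, t (n + 1) = t n + h n)
    (T : ℝ) (hT : T = t N)
    (ε ε₀ : ℝ) (hε : 0 < ε) (hε₀ : 0 < ε₀)
    (M β δφ δF Cbar C α lam : ℝ)
    (hM : 0 ≤ M) (hβ : 0 ≤ β) (hδφ : 0 ≤ δφ) (hδF : 0 ≤ δF)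
    (hCbar : 0 ≤ Cbar) (hC : 0 ≤ C) (hα : 0 ≤ α) (hlam : 0 < lam)
    (p q : ℕ) (hp : 1 ≤ p) (hq : 1 ≤ q)
    (y ψ : ℝ → EuclideanSpace ℝ (Fin d))
    (φex φθ : ℝ → EuclideanSpace ℝ (Fin d) → EuclideanSpace ℝ (Fin d))
    (Φ : ℕ → EuclideanSpace ℝ (Fin d) → EuclideanSpace ℝ (Fin d))
    -- the numerical sequence Y n = (Φ_{n−1} ∘ ⋯ ∘ Φ_0)(y 0)
    (Y : ℕ → EuclideanSpace ℝ (Fin d))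
    (hY0 : Y 0 = y 0) (hYrec : ∀ n < N, Y (n + 1) = Φ n (Y n))
    -- (i) same initial value
    (hinit : ψ 0 = y 0)
    -- (ii) averaging estimate with exponentially small remainder
    (havg : ∀ s ∈ Set.Icc (0 : ℝ) T,
      ‖y s - φex (s / ε) (ψ s)‖ ≤ M * Real.exp (-(β * ε₀) / ε))
    -- (iii) learning error of the high-oscillation generator
    (hlearn : ∀ (τ : ℝ) (z : EuclideanSpace ℝ (Fin d)),
      ‖φex τ z - φθ τ z‖ ≤ δφ * ε)
    -- (iv) Lipschitz bound for the learned generator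
    (hφθlip : ∀ (τ : ℝ) (y₁ y₂ : EuclideanSpace ℝ (Fin d)),
      ‖φθ τ y₁ - φθ τ y₂‖ ≤ (1 + α * ε) * ‖y₁ - y₂‖)
    -- (v) consistency of each step
    (hcons : ∀ n < N,
      ‖ψ (t (n + 1)) - Φ n (ψ (t n))‖ ≤ (Cbar * hplus ^ (p + q - 1) + C * δF) * h n)
    -- (vi) stability of each one-step map
    (hstab : ∀ n < N, ∀ y₁ y₂ : EuclideanSpace ℝ (Fin d),
      ‖Φ n y₁ - Φ n y₂‖ ≤ (1 + lam * h n) * ‖y₁ - y₂‖) :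
    ∀ n ≤ N,
      ‖y (t n) - φθ (t n / ε) (Y n)‖ ≤
        M * Real.exp (-(β * ε₀) / ε) + δφ * ε +
          (1 + α * ε) * ((Real.exp (lam * T) - 1) / lam) *
            (Cbar * hplus ^ (p + q - 1) + C * δF) := by
  have hK : 0 ≤ Cbar * hplus ^ (p + q - 1) + C * δF := by positivity
  generalize Cbar * hplus ^ (p + q - 1) + C * δF = K at *
  -- nonnegativity of the times
  have htn : ∀ n ≤ N, 0 ≤ t n := by
    intro n
    induction n with
    | zero => intro _; exact ht0.ge
    | succ k ih =>
      intro hk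
      have h1 := ih (by omega)
      have h2 := (hsteps k (by omega)).1
      rw [htrec k (by omega)]
      linarith
  -- times stay below T
  have htT : ∀ m n, n + m = N → t n ≤ T := by
    intro m
    induction m with
    | zero => intro n hn; rw [hT, ← hn]; simp
    | succ k ih =>
      intro n hn
      have h1 := ih (n + 1) (by omega)
      have h2 := (hsteps n (by omega)).1
      rw [htrec n (by omega)] at h1
      linarith
  -- global error of the slow numerical scheme
  have herr : ∀ n ≤ N, lam * ‖ψ (t n) - Y n‖ ≤ (Real.exp (lam * t n) - 1) * K := by
    intro n
    induction n with
    | zero => intro _; simp [ht0, hY0, hinit]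
    | succ k ih =>
      intro hk
      have h1 := ih (by omega)
      have h2 := (hsteps k (by omega)).1
      have h3 := hcons k (by omega)
      have h4 := hstab k (by omega) (ψ (t k)) (Y k)
      have h5 : ‖ψ (t (k + 1)) - Y (k + 1)‖ ≤ K * h k + (1 + lam * h k) * ‖ψ (t k) - Y k‖ := by
        rw [hYrec k (by omega)]
        exact (norm_sub_le_norm_sub_add_norm_sub _ (Φ k (ψ (t k))) _).trans (add_le_add h3 h4)
      have h6 : Real.exp (lam * t (k + 1)) = Real.exp (lam * t k) * Real.exp (lam * h k) := by
        rw [htrec k (by omega), mul_add, Real.exp_add]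
      have h7 : lam * h k + 1 ≤ Real.exp (lam * h k) := Real.add_one_le_exp _
      have h8 : 0 ≤ 1 + lam * h k := by positivity
      calc lam * ‖ψ (t (k + 1)) - Y (k + 1)‖
          ≤ lam * (K * h k + (1 + lam * h k) * ‖ψ (t k) - Y k‖) :=
            mul_le_mul_of_nonneg_left h5 hlam.le
        _ = lam * K * h k + (1 + lam * h k) * (lam * ‖ψ (t k) - Y k‖) := by ring
        _ ≤ lam * K * h k + (1 + lam * h k) * ((Real.exp (lam * t k) - 1) * K) := by gcongr
        _ = (Real.exp (lam * t k) * (lam * h k + 1) - 1) * K := by ring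
        _ ≤ (Real.exp (lam * t (k + 1)) - 1) * K := by rw [h6]; gcongr
  intro n hn
  have hnT : t n ≤ T := htT (N - n) n (by omega)
  have e1 := havg (t n) ⟨htn n hn, hnT⟩
  have e2 := hlearn (t n / ε) (ψ (t n))
  have e3 := hφθlip (t n / ε) (ψ (t n)) (Y n)
  have e4 : ‖ψ (t n) - Y n‖ ≤ (Real.exp (lam * T) - 1) / lam * K := by
    rw [div_mul_eq_mul_div, le_div_iff₀ hlam, mul_comm]
    refine (herr n hn).trans ?_
    gcongr
  have e5 : (1 + α * ε) * ‖ψ (t n) - Y n‖ ≤ (1 + α * ε) * ((Real.exp (lam * T) - 1) / lam) * K := by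
    rw [mul_assoc]
    exact mul_le_mul_of_nonneg_left e4 (by positivity)
  have e6 := norm_sub_le_norm_sub_add_norm_sub (y (t n)) (φex (t n / ε) (ψ (t n)))
    (φθ (t n / ε) (Y n))
  have e7 := norm_sub_le_norm_sub_add_norm_sub (φex (t n / ε) (ψ (t n)))
    (φθ (t n / ε) (ψ (t n))) (φθ (t n / ε) (Y n))
  linarith
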